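/- arXiv:1404.7711 — 2 statements merged into one kernel-verified Lean document; each statement's English description precedes it below -/
import Mathlib

section
/- Let A ⊆ {1,…,n} be nonempty with elements A_1 < … < A_{|A|}. Let R be the length of the longest run of consecutive indices in {1,…,n} not belonging to A, let L_i = A_1 − 1 and L_f = n − A_{|A|}. Then the coverage cost of the equispaced placement restricted to A satisfies C_0(x^eq_A) = max{ (R+1)/(2n), (2L_i+1)/(2n), (2L_f+1)/(2n) }. -/
open Finset MeasureTheory

/-- Coverage cost on the line `[0,1]` for placement `x` and active set `A`:
the largest distance from a point of `[0,1]` to the closest active sensor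
(`1` by convention if `A = ∅`). -/
noncomputable def cost0 {n : ℕ} (x : Fin n → ℝ) (A : Finset (Fin n)) : ℝ :=
  if A.Nonempty then ⨆ s : Set.Icc (0:ℝ) 1, ⨅ j : A, |s.1 - x j.1| else 1

/-- Probability that `A` is the active set, under independent failures with
probability `p`. -/
noncomputable def prob {n : ℕ} (p : ℝ) (A : Finset (Fin n)) : ℝ :=
  p ^ (n - A.card) * (1 - p) ^ A.card

/-- Expected coverage cost `C(x)` under independent failures with probability `p`. -/
noncomputable def expCost {n : ℕ} (p : ℝ) (x : Fin n → ℝ) : ℝ :=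
  ∑ A : Finset (Fin n), prob p A * cost0 x A

/-- The equispaced placement `x^eq`, whose `i`-th entry (`i = 0, …, n-1`) is
`(2i+1)/(2n)`. -/
noncomputable def xeq (n : ℕ) : Fin n → ℝ := fun i => (2 * (i : ℝ) + 1) / (2 * n)

/-- The `k`-th smallest element of the finite set `A` (0-based). -/
noncomputable def nth {n : ℕ} (A : Finset (Fin n)) (k : Fin A.card) : Fin n :=
  (A.orderIsoOfFin rfl k).1

/-- Coverage cost on the circle of circumference 1 for the active set `A`. -/
noncomputable def ccost0 {n : ℕ} (x : Fin n → ℝ) (A : Finset (Fin n)) : ℝ :=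
  if A.Nonempty then
    ⨆ s : Set.Icc (0:ℝ) 1, ⨅ j : A, min |s.1 - x j.1| (1 - |s.1 - x j.1|)
  else 1

/-- Expected circle coverage cost `C̃(x)`. -/
noncomputable def cExpCost {n : ℕ} (p : ℝ) (x : Fin n → ℝ) : ℝ :=
  ∑ A : Finset (Fin n), prob p A * ccost0 x A

/-- Harmonic number `H_m = ∑_{h=1}^m 1/h`. -/
noncomputable def H (m : ℕ) : ℝ := ∑ i ∈ Finset.range m, 1 / ((i : ℝ) + 1)

/-- Length of the longest run of consecutive indices of `{0, …, n-1}` not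
belonging to `A`. -/
noncomputable def longestRun {n : ℕ} (A : Finset (Fin n)) : ℕ :=
  sSup {r : ℕ | ∃ a : ℕ, a + r ≤ n ∧ ∀ i : Fin n, a ≤ i.1 → i.1 < a + r → i ∉ A}

/-- Expected cost in the Cortés (constant-number-of-failures) model where
exactly `k` sensors fail, uniformly at random. -/
noncomputable def cortesCost {n : ℕ} (k : ℕ) (x : Fin n → ℝ) : ℝ :=
  (n.choose k : ℝ)⁻¹ *
    ∑ A ∈ Finset.univ.filter (fun A : Finset (Fin n) => A.card = n - k), cost0 x A

/-- Expectation over the random uniform i.i.d. placement `x^rand ∈ [0,1]^n`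
of the expected cost `C(x^rand)`. -/
noncomputable def randExp (n : ℕ) (p : ℝ) : ℝ :=
  ∫ x in Set.univ.pi (fun _ : Fin n => Set.Icc (0:ℝ) 1), expCost p x

/-- `E[C_0(x^{rand,m})]`: expected coverage cost of `m` i.i.d. uniform sensors,
all active. -/
noncomputable def randCost0 (m : ℕ) : ℝ :=
  ∫ x in Set.univ.pi (fun _ : Fin m => Set.Icc (0:ℝ) 1), cost0 x Finset.univ

/-- `E[C^{k,n}(x^rand)]`: expectation over the random placement of the Cortés
model cost. -/
noncomputable def randCortes (n k : ℕ) : ℝ :=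
  ∫ x in Set.univ.pi (fun _ : Fin n => Set.Icc (0:ℝ) 1), cortesCost k x

/-- The run lengths of indices avoiding `A` are bounded by `n`. -/
lemma bddAbove_runs {n : ℕ} (A : Finset (Fin n)) :
    BddAbove {r : ℕ | ∃ a : ℕ, a + r ≤ n ∧ ∀ i : Fin n, a ≤ i.1 → i.1 < a + r → i ∉ A} :=
  ⟨n, by rintro r ⟨a, h, -⟩; omega⟩

lemma le_longestRun {n : ℕ} {A : Finset (Fin n)} {a r : ℕ} (h : a + r ≤ n)
    (hr : ∀ i : Fin n, a ≤ i.1 → i.1 < a + r → i ∉ A) : r ≤ longestRun A :=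
  le_csSup (bddAbove_runs A) ⟨a, h, hr⟩

lemma exists_longestRun {n : ℕ} (A : Finset (Fin n)) :
    ∃ a : ℕ, a + longestRun A ≤ n ∧
      ∀ i : Fin n, a ≤ i.1 → i.1 < a + longestRun A → i ∉ A :=
  Nat.sSup_mem (s := {r : ℕ | ∃ a : ℕ, a + r ≤ n ∧
      ∀ i : Fin n, a ≤ i.1 → i.1 < a + r → i ∉ A})
    ⟨0, 0, by omega, fun _ _ _ => by omega⟩ (bddAbove_runs A)

lemma nth_mem {n : ℕ} (A : Finset (Fin n)) (k : Fin A.card) : nth A k ∈ A :=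
  (A.orderIsoOfFin rfl k).2

lemma nth_mono {n : ℕ} (A : Finset (Fin n)) : Monotone (nth A) :=
  fun _ _ h => (A.orderIsoOfFin rfl).monotone h

lemma exists_nth_eq {n : ℕ} {A : Finset (Fin n)} {j : Fin n} (hj : j ∈ A) :
    ∃ k, nth A k = j :=
  ⟨(A.orderIsoOfFin rfl).symm ⟨j, hj⟩, by simp [nth]⟩

lemma cost0_le {n : ℕ} {x : Fin n → ℝ} {A : Finset (Fin n)} (hA : A.Nonempty) {c : ℝ}
    (h : ∀ s ∈ Set.Icc (0 : ℝ) 1, ∃ j ∈ A, |s - x j| ≤ c) : cost0 x A ≤ c := by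
  rw [cost0, if_pos hA]
  refine ciSup_le fun s => ?_
  obtain ⟨j, hj, hjc⟩ := h s.1 s.2
  exact (ciInf_le (Set.finite_range _).bddBelow (⟨j, hj⟩ : A)).trans hjc

lemma le_cost0 {n : ℕ} {x : Fin n → ℝ} {A : Finset (Fin n)} (hA : A.Nonempty) {c s : ℝ}
    (hs : s ∈ Set.Icc (0 : ℝ) 1) (h : ∀ j ∈ A, c ≤ |s - x j|) : c ≤ cost0 x A := by
  rw [cost0, if_pos hA]
  have : Nonempty A := hA.to_subtype
  have hbdd : BddAbove (Set.range fun s : Set.Icc (0 : ℝ) 1 => ⨅ j : A, |s.1 - x j.1|) := by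
    obtain ⟨j, hj⟩ := hA
    refine ⟨1 + |x j|, ?_⟩
    rintro _ ⟨t, rfl⟩
    refine (ciInf_le (Set.finite_range _).bddBelow (⟨j, hj⟩ : A)).trans
      ((abs_sub _ _).trans ?_)
    gcongr
    exact abs_le.2 ⟨by linarith [t.2.1], t.2.2⟩
  exact (le_ciInf fun j : A => h j.1 j.2).trans (le_ciSup hbdd ⟨s, hs⟩)

/-- A point lying between two active sensors of the equispaced placement is within
`(longestRun A + 1) / (2 * n)` of an active sensor. -/
lemma exists_abs_sub_xeq_le {n : ℕ} (hn : 1 ≤ n) {A : Finset (Fin n)} {s : ℝ} {l r : Fin n}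
    (hl : l ∈ A) (hls : xeq n l ≤ s) (hr : r ∈ A) (hsr : s < xeq n r) :
    ∃ j ∈ A, |s - xeq n j| ≤ ((longestRun A : ℝ) + 1) / (2 * n) := by
  have hn0 : (0 : ℝ) < 2 * n := by positivity
  obtain ⟨p, hp, hpmax⟩ := (A.filter (fun j => xeq n j ≤ s)).exists_max_image id
    ⟨l, by simp [hl, hls]⟩
  obtain ⟨q, hq, hqmin⟩ := (A.filter (fun j => s < xeq n j)).exists_min_image id
    ⟨r, by simp [hr, hsr]⟩
  simp only [Finset.mem_filter, id, and_imp] at hp hpmax hq hqmin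
  have hgap : q.1 - (p.1 + 1) ≤ longestRun A := by
    refine le_longestRun (a := p.1 + 1) (by omega) fun i hpi hiq hi => ?_
    rcases le_or_gt (xeq n i) s with h | h
    · have := Fin.le_def.1 (hpmax i hi h)
      omega
    · have := Fin.le_def.1 (hqmin i hi h)
      omega
  have hgap' : (q : ℝ) ≤ p + 1 + longestRun A := by
    exact_mod_cast (by omega : q.1 ≤ p.1 + 1 + longestRun A)
  have hdist : (xeq n q - s) + (s - xeq n p) ≤ 2 * (((longestRun A : ℝ) + 1) / (2 * n)) := by
    have : (xeq n q - s) + (s - xeq n p) = 2 * (((q : ℝ) - p) / (2 * n)) := by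
      simp only [xeq]
      ring
    rw [this]
    gcongr
    linarith
  rcases le_total (s - xeq n p) (xeq n q - s) with h | h
  · exact ⟨p, hp.1, by rw [abs_of_nonneg (by linarith)]; linarith⟩
  · exact ⟨q, hq.1, by rw [abs_of_neg (by linarith)]; linarith⟩

/-- The midpoint of a run of `r` indices is far from every sensor outside the run. -/
lemma le_abs_midpoint_sub_xeq {n : ℕ} (hn : 1 ≤ n) {j : Fin n} {a r : ℕ}
    (hj : j.1 < a ∨ a + r ≤ j.1) :
    ((r : ℝ) + 1) / (2 * n) ≤ |(2 * (a : ℝ) + r) / (2 * n) - xeq n j| := by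
  have hn0 : (0 : ℝ) < 2 * n := by positivity
  rw [xeq, ← sub_div, abs_div, abs_of_pos hn0]
  gcongr
  rcases hj with h | h
  · have : (j : ℝ) + 1 ≤ a := by exact_mod_cast h
    exact le_abs.2 (.inl (by linarith))
  · have : (a : ℝ) + r ≤ j := by exact_mod_cast h
    exact le_abs.2 (.inr (by linarith))

/-- for nonempty `A`, with `R` the longest run of failed sensors,
`L_i` the initial run and `L_f` the final run of failures,
`C_0(x^eq_A) = max{(R+1)/(2n), (2L_i+1)/(2n), (2L_f+1)/(2n)}`.
(In 0-based indexing, `L_i` is the value of the smallest element of `A` and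
`L_f = n - 1 -` the value of the largest element of `A`.) -/
theorem cost0_xeq_eq_max_runs {n : ℕ} (hn : 1 ≤ n) (A : Finset (Fin n))
    (hA : A.Nonempty) :
    cost0 (xeq n) A =
      max (((longestRun A : ℝ) + 1) / (2 * n))
        (max ((2 * ((nth A ⟨0, hA.card_pos⟩).val : ℝ) + 1) / (2 * n))
          ((2 * ((n : ℝ) - 1 -
              ((nth A ⟨A.card - 1, by have := hA.card_pos; omega⟩).val : ℝ)) + 1)
            / (2 * n))) := by
  have hn0 : (0 : ℝ) < 2 * n := by positivity
  have hc := hA.card_pos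
  set f := nth A ⟨0, hA.card_pos⟩
  set l := nth A ⟨A.card - 1, by omega⟩
  have hfA : f ∈ A := nth_mem A _
  have hlA : l ∈ A := nth_mem A _
  have hmin : ∀ j ∈ A, f ≤ j := by
    intro j hj
    obtain ⟨k, rfl⟩ := exists_nth_eq hj
    exact nth_mono A (Fin.le_def.2 (Nat.zero_le _))
  have hmax : ∀ j ∈ A, j ≤ l := by
    intro j hj
    obtain ⟨k, rfl⟩ := exists_nth_eq hj
    exact nth_mono A (Fin.le_def.2 (by have := k.2; simp only; omega))
  have hlast : (2 * ((n : ℝ) - 1 - (l.val : ℝ)) + 1) / (2 * n) = 1 - xeq n l := by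
    rw [xeq]
    field_simp
    ring
  rw [hlast]
  change _ = max _ (max (xeq n f) _)
  have hxmono : Monotone (xeq n) := by
    intro i j hij
    have : (i : ℝ) ≤ j := by exact_mod_cast Fin.le_def.1 hij
    unfold xeq
    gcongr
  apply le_antisymm
  · refine cost0_le hA fun s hs => ?_
    rcases lt_or_ge s (xeq n f) with h | h
    · refine ⟨f, hfA, le_max_of_le_right (le_max_of_le_left ?_)⟩
      rw [abs_of_neg (by linarith)]
      linarith [hs.1]
    rcases lt_or_ge s (xeq n l) with h' | h'
    · obtain ⟨j, hj, hle⟩ := exists_abs_sub_xeq_le hn hfA h hlA h'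
      exact ⟨j, hj, le_max_of_le_left hle⟩
    · refine ⟨l, hlA, le_max_of_le_right (le_max_of_le_right ?_)⟩
      rw [abs_of_nonneg (by linarith)]
      linarith [hs.2]
  · refine max_le ?_ (max_le ?_ ?_)
    · obtain ⟨a, han, ha⟩ := exists_longestRun A
      refine le_cost0 hA (s := (2 * (a : ℝ) + longestRun A) / (2 * n)) ⟨by positivity, ?_⟩ ?_
      · rw [div_le_one hn0]
        exact_mod_cast (by omega : 2 * a + longestRun A ≤ 2 * n)
      · intro j hj
        refine le_abs_midpoint_sub_xeq hn ?_
        by_contra! h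
        exact ha j h.1 h.2 hj
    · refine le_cost0 hA (s := 0) (by simp) fun j hj => ?_
      exact le_abs.2 (.inr (by linarith [hxmono (hmin j hj)]))
    · refine le_cost0 hA (s := 1) (by simp) fun j hj => ?_
      exact le_abs.2 (.inl (by linarith [hxmono (hmax j hj)]))
end

section
/- For every n ≥ 1 there exists ε > 0 such that for every failure probability p ∈ (0, ε), the equispaced placement x^eq is optimal: C(x^eq) ≤ C(x) for all x ∈ [0,1]^n (where C depends on p). -/
open Finset MeasureTheory

lemma iInf_dist_le {n : ℕ} (x : Fin n → ℝ) {A : Finset (Fin n)} {j : Fin n} (hj : j ∈ A)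
    (s : ℝ) : ⨅ k : A, |s - x k.1| ≤ |s - x j| :=
  ciInf_le (Set.finite_range fun k : A => |s - x k.1|).bddBelow (⟨j, hj⟩ : A)

lemma bddAbove_range_iInf_dist {n : ℕ} (x : Fin n → ℝ) {A : Finset (Fin n)} (hA : A.Nonempty) :
    BddAbove (Set.range fun s : Set.Icc (0:ℝ) 1 => ⨅ k : A, |s.1 - x k.1|) := by
  obtain ⟨j, hj⟩ := hA
  refine ⟨1 + |x j|, ?_⟩
  rintro _ ⟨⟨s, hs0, hs1⟩, rfl⟩
  refine (iInf_dist_le x hj s).trans ((abs_sub _ _).trans ?_)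
  rw [abs_of_nonneg hs0]
  linarith

/-- Every point of `[0,1]` lies within the coverage cost of some active sensor. -/
lemma exists_dist_le_cost0 {n : ℕ} (x : Fin n → ℝ) {A : Finset (Fin n)} (hA : A.Nonempty)
    {s : ℝ} (hs : s ∈ Set.Icc (0:ℝ) 1) : ∃ j ∈ A, |s - x j| ≤ cost0 x A := by
  have : Nonempty A := hA.to_subtype
  obtain ⟨j, hj⟩ := exists_eq_ciInf_of_finite (f := fun k : A => |s - x k.1|)
  refine ⟨j.1, j.2, ?_⟩
  rw [cost0, if_pos hA]
  exact hj.trans_le (le_ciSup (bddAbove_range_iInf_dist x hA) ⟨s, hs⟩)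

lemma cost0_le_of_forall_exists {n : ℕ} (x : Fin n → ℝ) {A : Finset (Fin n)} (hA : A.Nonempty)
    {r : ℝ} (h : ∀ s ∈ Set.Icc (0:ℝ) 1, ∃ j ∈ A, |s - x j| ≤ r) : cost0 x A ≤ r := by
  rw [cost0, if_pos hA]
  have : Nonempty (Set.Icc (0:ℝ) 1) := ⟨⟨0, by simp⟩⟩
  refine ciSup_le fun s => ?_
  obtain ⟨j, hj, hjr⟩ := h s.1 s.2
  exact (iInf_dist_le x hj s.1).trans hjr

/-- The coverage cost is 1-Lipschitz in the placement for the sup distance. -/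
lemma cost0_le_cost0_add {n : ℕ} (x y : Fin n → ℝ) (A : Finset (Fin n)) {δ : ℝ} (hδ : 0 ≤ δ)
    (h : ∀ i, |y i - x i| ≤ δ) : cost0 x A ≤ cost0 y A + δ := by
  by_cases hA : A.Nonempty
  · refine cost0_le_of_forall_exists x hA fun s hs => ?_
    obtain ⟨j, hj, hjr⟩ := exists_dist_le_cost0 y hA hs
    exact ⟨j, hj, (abs_sub_le s (y j) (x j)).trans (add_le_add hjr (h j))⟩
  · simp [cost0, hA, hδ]

lemma cost0_comp_perm {n : ℕ} (x : Fin n → ℝ) (σ : Equiv.Perm (Fin n)) (A : Finset (Fin n)) :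
    cost0 (x ∘ σ) A = cost0 x (A.map σ.toEmbedding) := by
  by_cases hA : A.Nonempty
  · have hA' : (A.map σ.toEmbedding).Nonempty := hA.map
    apply le_antisymm
    · refine cost0_le_of_forall_exists _ hA fun s hs => ?_
      obtain ⟨j, hj, hjr⟩ := exists_dist_le_cost0 x hA' hs
      obtain ⟨i, hi, rfl⟩ := Finset.mem_map.1 hj
      exact ⟨i, hi, hjr⟩
    · refine cost0_le_of_forall_exists _ hA' fun s hs => ?_
      obtain ⟨j, hj, hjr⟩ := exists_dist_le_cost0 (x ∘ σ) hA hs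
      exact ⟨σ j, Finset.mem_map_of_mem σ.toEmbedding hj, hjr⟩
  · simp [cost0, hA]

lemma expCost_comp_perm {n : ℕ} (p : ℝ) (x : Fin n → ℝ) (σ : Equiv.Perm (Fin n)) :
    expCost p (x ∘ σ) = expCost p x := by
  unfold expCost
  refine Fintype.sum_equiv σ.finsetCongr _ _ fun A => ?_
  rw [cost0_comp_perm]
  simp [prob]

/-- In a sorted placement, sensors `k` indices apart are within `2 * k` times the coverage cost. -/
lemma le_add_of_monotone {n : ℕ} {x : Fin n → ℝ} (hx : ∀ i, x i ∈ Set.Icc (0:ℝ) 1)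
    (hmono : Monotone x) (k : ℕ) (i j : Fin n) (hij : j.1 = i.1 + k) :
    x j ≤ x i + 2 * k * cost0 x univ := by
  induction k generalizing j with
  | zero =>
    obtain rfl : j = i := Fin.ext hij
    simp
  | succ k ih =>
    have hlt : i.1 + k < n := by omega
    have hprev := ih ⟨i.1 + k, hlt⟩ rfl
    set l : Fin n := ⟨i.1 + k, hlt⟩ with hl
    obtain ⟨m, -, hm⟩ := exists_dist_le_cost0 x (A := univ) ⟨i, mem_univ i⟩
      (s := (x l + x j) / 2)
      ⟨by linarith [(hx l).1, (hx j).1], by linarith [(hx l).2, (hx j).2]⟩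
    have hgap : x j - x l ≤ 2 * cost0 x univ := by
      rw [abs_le] at hm
      rcases le_or_gt m l with hml | hml
      · linarith [hmono hml]
      · have hjm : j ≤ m := by
          rw [Fin.lt_def] at hml
          rw [Fin.le_def]
          simp only [hl] at hml
          omega
        linarith [hmono hjm]
    push_cast
    linarith

/-- A sorted placement is close to the equispaced one when its coverage cost is close to
`1 / (2 * n)`. -/
lemma abs_sub_xeq_le {n : ℕ} (hn : 1 ≤ n) {x : Fin n → ℝ} (hx : ∀ i, x i ∈ Set.Icc (0:ℝ) 1)
    (hmono : Monotone x) (i : Fin n) :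
    0 ≤ cost0 x univ - 1 / (2 * n) ∧
      |x i - xeq n i| ≤ 2 * n * (cost0 x univ - 1 / (2 * n)) := by
  have hn0 : (0:ℝ) < n := by exact_mod_cast hn
  have huniv : (univ : Finset (Fin n)).Nonempty := ⟨i, mem_univ i⟩
  set r := cost0 x univ
  have hupper : x i ≤ (2 * (i : ℝ) + 1) * r := by
    have h1 := le_add_of_monotone hx hmono i.1 ⟨0, hn⟩ i (by simp)
    obtain ⟨m, -, hm⟩ := exists_dist_le_cost0 x huniv (s := 0) (by simp)
    have h2 : x ⟨0, hn⟩ ≤ x m := hmono (by simp [Fin.le_def])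
    rw [abs_le] at hm
    linarith
  have hlower : 1 - (2 * ((n : ℝ) - i) - 1) * r ≤ x i := by
    have hi := i.2
    have h1 := le_add_of_monotone hx hmono (n - 1 - i.1) i ⟨n - 1, by omega⟩ (by simp; omega)
    obtain ⟨m, -, hm⟩ := exists_dist_le_cost0 x huniv (s := 1) (by simp)
    have h2 : x m ≤ x ⟨n - 1, by omega⟩ := hmono (by rw [Fin.le_def]; simp; omega)
    rw [abs_le] at hm
    have hcast : ((n - 1 - i.1 : ℕ) : ℝ) = n - 1 - i := by
      rw [Nat.cast_sub (by omega), Nat.cast_sub hn, Nat.cast_one]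
    rw [hcast] at h1
    linarith
  obtain ⟨d, hd⟩ : ∃ d, d = r - 1 / (2 * n) := ⟨_, rfl⟩
  have hrd : r = d + 1 / (2 * n) := by linarith
  have hinv : (n : ℝ) * (1 / (2 * n)) = 1 / 2 := by field_simp
  have hxeq : xeq n i = (2 * (i : ℝ) + 1) * (1 / (2 * n)) := by
    rw [xeq]; ring
  rw [← hd, hxeq]
  rw [hrd] at hupper hlower
  have hi0 : (0:ℝ) ≤ i := Nat.cast_nonneg _
  have hi1 : (i : ℝ) + 1 ≤ n := by exact_mod_cast i.2
  have hd0 : 0 ≤ d := by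
    have h : 0 ≤ (2 * n) * d := by linarith
    exact nonneg_of_mul_nonneg_right h (by positivity)
  refine ⟨hd0, abs_le.2 ⟨?_, ?_⟩⟩
  · nlinarith [mul_nonneg hi0 hd0]
  · nlinarith [mul_le_mul_of_nonneg_right hi1 hd0]

lemma cost0_xeq_univ_le {n : ℕ} (hn : 1 ≤ n) : cost0 (xeq n) univ ≤ 1 / (2 * n) := by
  have hn0 : (0:ℝ) < n := by exact_mod_cast hn
  refine cost0_le_of_forall_exists _ ⟨⟨0, hn⟩, mem_univ _⟩ fun s hs => ?_
  obtain ⟨j, h1, h2⟩ : ∃ j : Fin n, (j : ℝ) ≤ n * s ∧ n * s ≤ j + 1 := by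
    rcases hs.2.lt_or_eq with h | rfl
    · have hns : 0 ≤ n * s := mul_nonneg hn0.le hs.1
      exact ⟨⟨⌊n * s⌋₊, (Nat.floor_lt hns).2 (by nlinarith)⟩, Nat.floor_le hns,
        (Nat.lt_floor_add_one _).le⟩
    · exact ⟨⟨n - 1, by omega⟩, by simp, by simp [Nat.cast_sub hn]⟩
  refine ⟨j, mem_univ j, ?_⟩
  have hdiff : s - xeq n j = (2 * (n * s) - (2 * j + 1)) / (2 * n) := by
    rw [xeq]; field_simp
  rw [hdiff, abs_div, abs_of_pos (by positivity : (0:ℝ) < 2 * n)]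
  gcongr
  exact abs_le.2 ⟨by linarith, by linarith⟩

lemma prob_nonneg {n : ℕ} {p : ℝ} (hp0 : 0 ≤ p) (hp1 : p ≤ 1) (A : Finset (Fin n)) :
    0 ≤ prob p A :=
  mul_nonneg (pow_nonneg hp0 _) (pow_nonneg (by linarith) _)

lemma prob_le_of_ne_univ {n : ℕ} {p : ℝ} (hp0 : 0 ≤ p) (hp1 : p ≤ 1) {A : Finset (Fin n)}
    (hA : A ≠ univ) : prob p A ≤ p := by
  have hcard : A.card < n := by
    simpa using Finset.card_lt_card (Finset.ssubset_univ_iff.2 hA)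
  calc prob p A ≤ p * 1 :=
        mul_le_mul (pow_le_of_le_one hp0 hp1 (by omega))
          (pow_le_one₀ (by linarith) (by linarith)) (pow_nonneg (by linarith) _) hp0
    _ = p := mul_one p

lemma expCost_xeq_le_of_monotone {n : ℕ} (hn : 1 ≤ n) {p : ℝ} (hp0 : 0 ≤ p)
    (hp : p * (n + 2 * n * 2 ^ n) ≤ 1) {x : Fin n → ℝ} (hx : ∀ i, x i ∈ Set.Icc (0:ℝ) 1)
    (hmono : Monotone x) : expCost p (xeq n) ≤ expCost p x := by
  have hn1 : (1:ℝ) ≤ n := by exact_mod_cast hn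
  have hp1 : p ≤ 1 := by
    have h : (0:ℝ) ≤ 2 * n * 2 ^ n := by positivity
    nlinarith
  have hd0 := (abs_sub_xeq_le hn hx hmono ⟨0, hn⟩).1
  have hclose := fun i => (abs_sub_xeq_le hn hx hmono i).2
  set d := cost0 x univ - 1 / (2 * n) with hd
  have hδ : 0 ≤ 2 * n * d := by positivity
  have hfull : prob p (univ : Finset (Fin n)) * cost0 (xeq n) univ
      ≤ prob p (univ : Finset (Fin n)) * cost0 x univ - (1 - p) ^ n * d := by
    have h : cost0 (xeq n) univ ≤ cost0 x univ - d := by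
      linarith [cost0_xeq_univ_le hn]
    have hprob : prob p (univ : Finset (Fin n)) = (1 - p) ^ n := by simp [prob]
    rw [hprob, ← mul_sub]
    exact mul_le_mul_of_nonneg_left h (pow_nonneg (by linarith) _)
  have hterm : ∀ A ∈ (univ : Finset (Finset (Fin n))).erase univ,
      prob p A * cost0 (xeq n) A ≤ prob p A * cost0 x A + p * (2 * n * d) := by
    intro A hA
    calc prob p A * cost0 (xeq n) A ≤ prob p A * (cost0 x A + 2 * n * d) :=
          mul_le_mul_of_nonneg_left (cost0_le_cost0_add _ _ A hδ hclose)
            (prob_nonneg hp0 hp1 A)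
      _ ≤ _ := by
          rw [mul_add]
          gcongr
          exact prob_le_of_ne_univ hp0 hp1 (Finset.ne_of_mem_erase hA)
  have hrest := Finset.sum_le_sum hterm
  rw [Finset.sum_add_distrib, Finset.sum_const, nsmul_eq_mul] at hrest
  have hcount : (((univ : Finset (Finset (Fin n))).erase univ).card : ℝ) ≤ 2 ^ n := by
    have h := Finset.card_erase_le (s := (univ : Finset (Finset (Fin n)))) (a := univ)
    rw [Finset.card_univ, Fintype.card_finset, Fintype.card_fin] at h
    exact_mod_cast h
  have hsmall := mul_le_mul_of_nonneg_right hcount (mul_nonneg hp0 hδ)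
  have hbern : 2 ^ n * (p * (2 * n * d)) ≤ (1 - p) ^ n * d := by
    have h := one_add_mul_le_pow (a := -p) (by linarith) n
    rw [← sub_eq_add_neg] at h
    have h' : 2 ^ n * (p * (2 * n)) ≤ (1 - p) ^ n := by linarith
    calc 2 ^ n * (p * (2 * n * d)) = 2 ^ n * (p * (2 * n)) * d := by ring
      _ ≤ _ := mul_le_mul_of_nonneg_right h' hd0
  rw [expCost, expCost, ← Finset.add_sum_erase _ _ (mem_univ univ),
    ← Finset.add_sum_erase _ (fun A => prob p A * cost0 x A) (mem_univ univ)]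
  linarith

/-- for every `n ≥ 1` there is `ε > 0` such that for every
failure probability `p ∈ (0, ε)` the equispaced placement is optimal. -/
theorem xeq_optimal_small_p {n : ℕ} (hn : 1 ≤ n) :
    ∃ ε : ℝ, 0 < ε ∧ ∀ p : ℝ, 0 < p → p < ε →
      ∀ x : Fin n → ℝ, (∀ i, x i ∈ Set.Icc (0:ℝ) 1) →
        expCost p (xeq n) ≤ expCost p x := by
  have hn0 : (0:ℝ) < n := by exact_mod_cast hn
  refine ⟨1 / (n + 2 * n * 2 ^ n), by positivity, fun p hp0 hp x hx => ?_⟩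
  rw [← expCost_comp_perm p x (Tuple.sort x)]
  exact expCost_xeq_le_of_monotone hn hp0.le ((lt_div_iff₀ (by positivity)).1 hp).le
    (fun i => hx _) (Tuple.monotone_sort x)
end
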